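/- Let k ≥ 1 be a natural number, let ℓ ≥ 1 and b_0 > 0 be real numbers, and let a_1 := ℓ − 1 and a_0 be real numbers such that a_1·N + a_0 > 0 for every natural number N ≥ 1. Then, as N → ∞, I_k(N; a_1·N + a_0, b_0)/N converges to (ℓ/(1+ℓ)^{2k−1}) · Σ_{i=0}^{2(k−1)} binom(k−1, ⌈i/2⌉) · binom(k−1, ⌊i/2⌋) · ℓ^i, where ⌈i/2⌉ and ⌊i/2⌋ denote the ceiling and floor of i/2. -/

import Mathlib

open Finset MeasureTheory

/-- The Jacobi-ensemble average `⟨f⟩_{a,b}` over `[0,1]^N`. -/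
noncomputable def jacobiAvg (N : ℕ) (a b : ℝ) (f : (Fin N → ℝ) → ℝ) : ℝ :=
  ((N.factorial : ℝ))⁻¹ *
    ∫ x in Set.univ.pi (fun _ : Fin N => Set.Icc (0 : ℝ) 1),
      f x * (∏ i, ∏ j ∈ Finset.Ioi i, (x i - x j) ^ 2) *
        ∏ i, x i ^ (a - 1) * (1 - x i) ^ (b - 1)

/-- `I_k = ⟨p_k⟩_{a,b} / ⟨1⟩_{a,b}` where `p_k` is the `k`-th power sum. -/
noncomputable def Ik (k N : ℕ) (a b : ℝ) : ℝ :=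
  jacobiAvg N a b (fun x => ∑ i, x i ^ k) / jacobiAvg N a b (fun _ => 1)

/-- The generating polynomial of symmetric Dyck paths of semi-length `2 n + 1` by peaks. -/
noncomputable def symmDyckPoly (n : ℕ) : Polynomial ℝ :=
  ∑ i ∈ Finset.range (2 * n + 1),
    Polynomial.monomial i ((n.choose ((i + 1) / 2) : ℝ) * (n.choose (i / 2) : ℝ))

theorem coeff_symmDyckPoly (n i : ℕ) :
    (symmDyckPoly n).coeff i = (n.choose ((i + 1) / 2) : ℝ) * (n.choose (i / 2) : ℝ) := by
  simp only [symmDyckPoly, Polynomial.finsetSum_coeff, Polynomial.coeff_monomial]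
  rw [Finset.sum_ite_eq']
  split_ifs with h
  · rfl
  · rw [Finset.mem_range] at h
    rw [Nat.choose_eq_zero_of_lt (show n < (i + 1) / 2 by omega)]
    simp

theorem cast_choose_succ_mul (m j : ℕ) :
    (m.choose (j + 1) : ℝ) * (j + 1) = m.choose j * (m - j) := by
  rcases le_or_gt j m with h | h
  · have := Nat.choose_succ_right_eq m j
    rw [← Nat.cast_sub h]
    exact_mod_cast this
  · rw [Nat.choose_eq_zero_of_lt h, Nat.choose_eq_zero_of_lt (h.trans (Nat.lt_succ_self j))]
    simp

theorem symmDyckPoly_recurrence (m : ℕ) :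
    Polynomial.C (m + 3 : ℝ) * symmDyckPoly (m + 2) +
        Polynomial.C (m + 1 : ℝ) * symmDyckPoly m +
        Polynomial.X ^ 4 * (Polynomial.C (m + 1 : ℝ) * symmDyckPoly m) =
      Polynomial.C (2 * (m + 2) : ℝ) * symmDyckPoly (m + 1) +
        Polynomial.X ^ 2 * (Polynomial.C (2 * (m + 2) : ℝ) * symmDyckPoly (m + 1)) +
        Polynomial.X ^ 1 * (Polynomial.C (2 : ℝ) * symmDyckPoly (m + 1)) +
        Polynomial.X ^ 2 * (Polynomial.C (2 * (m + 1) : ℝ) * symmDyckPoly m) := by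
  ext i
  simp only [Polynomial.coeff_add, Polynomial.coeff_X_pow_mul', Polynomial.coeff_C_mul,
    coeff_symmDyckPoly]
  obtain ⟨t, rfl | rfl⟩ := Nat.even_or_odd' i
  · rcases t with _ | _ | j
    · norm_num
      ring
    · norm_num
      ring
    · have r1 := cast_choose_succ_mul m (j + 1)
      have r2 := cast_choose_succ_mul m j
      rw [if_pos (by omega), if_pos (by omega), if_pos (by omega), if_pos (by omega),
        show (2 * (j + 1 + 1) + 1) / 2 = j + 1 + 1 by omega,
        show 2 * (j + 1 + 1) / 2 = j + 1 + 1 by omega,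
        show (2 * (j + 1 + 1) - 4 + 1) / 2 = j by omega,
        show (2 * (j + 1 + 1) - 4) / 2 = j by omega,
        show (2 * (j + 1 + 1) - 2 + 1) / 2 = j + 1 by omega,
        show (2 * (j + 1 + 1) - 2) / 2 = j + 1 by omega,
        show (2 * (j + 1 + 1) - 1 + 1) / 2 = j + 1 + 1 by omega,
        show (2 * (j + 1 + 1) - 1) / 2 = j + 1 by omega]
      simp only [Nat.choose_succ_succ']
      push_cast at r1 r2 ⊢
      linear_combination 2 * ((m.choose j : ℝ) + m.choose (j + 1)) * r1 -
        2 * ((m.choose (j + 1 + 1) : ℝ) + m.choose (j + 1)) * r2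
  · rcases t with _ | _ | j
    · norm_num
      ring
    · have r0 := cast_choose_succ_mul m 1
      norm_num [Nat.choose_succ_succ'] at r0 ⊢
      linear_combination r0
    · have r0 := cast_choose_succ_mul m (j + 2)
      have r2 := cast_choose_succ_mul m j
      rw [if_pos (by omega), if_pos (by omega), if_pos (by omega), if_pos (by omega),
        show (2 * (j + 1 + 1) + 1 + 1) / 2 = j + 1 + 1 + 1 by omega,
        show (2 * (j + 1 + 1) + 1) / 2 = j + 1 + 1 by omega,
        show (2 * (j + 1 + 1) + 1 - 4 + 1) / 2 = j + 1 by omega,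
        show (2 * (j + 1 + 1) + 1 - 4) / 2 = j by omega,
        show (2 * (j + 1 + 1) + 1 - 2 + 1) / 2 = j + 1 + 1 by omega,
        show (2 * (j + 1 + 1) + 1 - 2) / 2 = j + 1 by omega,
        show (2 * (j + 1 + 1) + 1 - 1 + 1) / 2 = j + 1 + 1 by omega,
        show (2 * (j + 1 + 1) + 1 - 1) / 2 = j + 1 + 1 by omega]
      simp only [Nat.choose_succ_succ']
      push_cast at r0 r2 ⊢
      linear_combination ((m.choose j : ℝ) + m.choose (j + 1)) * r0 -
        ((m.choose (j + 1 + 1 + 1) : ℝ) + m.choose (j + 1 + 1)) * r2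

/-- The limiting moments: `1` for the zeroth one, then the symmetric Dyck path polynomials. -/
noncomputable def dyckMoment (ℓ : ℝ) : ℕ → ℝ
  | 0 => 1
  | k + 1 => ℓ / (1 + ℓ) ^ (2 * k + 1) * (symmDyckPoly k).eval ℓ

theorem dyckMoment_recurrence {ℓ : ℝ} (hℓ : 0 < ℓ) (m : ℕ) :
    (1 + ℓ) ^ 2 * (m + 3) * dyckMoment ℓ (m + 3) =
      ((2 + 2 * ℓ ^ 2) * (m + 2) + 2 * ℓ) * dyckMoment ℓ (m + 2) -
        (ℓ - 1) ^ 2 * (m + 1) * dyckMoment ℓ (m + 1) := by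
  have h := congrArg (Polynomial.eval ℓ) (symmDyckPoly_recurrence m)
  simp only [Polynomial.eval_add, Polynomial.eval_mul, Polynomial.eval_C, Polynomial.eval_pow,
    Polynomial.eval_X] at h
  have h1 : (1 + ℓ) ≠ 0 := by positivity
  simp only [dyckMoment]
  have p1 : (1 + ℓ) ^ (2 * (m + 1) + 1) = (1 + ℓ) ^ (2 * m + 1) * (1 + ℓ) ^ 2 := by ring
  have p2 : (1 + ℓ) ^ (2 * (m + 2) + 1) = (1 + ℓ) ^ (2 * m + 1) * (1 + ℓ) ^ 4 := by ring
  rw [p1, p2]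
  have hq : (1 + ℓ) ^ (2 * m + 1) ≠ 0 := pow_ne_zero _ h1
  generalize (1 + ℓ) ^ (2 * m + 1) = q at hq ⊢
  field_simp
  linear_combination h

open PowerSeries in
theorem dyckMoment_generating_eq {ℓ : ℝ} (hℓ : 0 < ℓ) :
    (1 - X) * (PowerSeries.mk (dyckMoment ℓ) ^ 2 +
      PowerSeries.C (ℓ - 1) * PowerSeries.mk (dyckMoment ℓ)) = PowerSeries.C ℓ := by
  set G := PowerSeries.mk (dyckMoment ℓ) with hG
  set s := (1 + ℓ) ^ 2 with hs
  set d := (ℓ - 1) ^ 2 with hd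
  have hs0 : s ≠ 0 := by positivity
  set H : PowerSeries ℝ := PowerSeries.C 2 * G + PowerSeries.C (ℓ - 1) with hH
  have hH' : derivative ℝ H = PowerSeries.C 2 * derivative ℝ G := by
    simp [hH]
  have hode : (PowerSeries.C s - PowerSeries.C d * X) * (1 - X) * derivative ℝ H =
      PowerSeries.C (2 * ℓ) * H := by
    rw [hH', hH]
    have e : (PowerSeries.C s - PowerSeries.C d * X) * (1 - X) *
        (PowerSeries.C 2 * derivative ℝ G) =
        PowerSeries.C (2 * s) * derivative ℝ G -
          X * (PowerSeries.C (2 * (s + d)) * derivative ℝ G) +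
          X * (X * (PowerSeries.C (2 * d) * derivative ℝ G)) := by
      simp only [map_mul, map_add]
      ring
    have m0 : dyckMoment ℓ 0 = 1 := rfl
    have m1 : dyckMoment ℓ 1 = ℓ / (1 + ℓ) := by simp [dyckMoment, symmDyckPoly]
    have m2 : dyckMoment ℓ 2 = ℓ / (1 + ℓ) ^ 3 * (1 + ℓ + ℓ ^ 2) := by
      simp [dyckMoment, symmDyckPoly, Finset.sum_range_succ]
    rw [e]
    ext n
    rcases n with _ | _ | m
    · simp only [map_add, map_sub, coeff_zero_X_mul, PowerSeries.coeff_C_mul,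
        coeff_derivative, hG, coeff_mk, PowerSeries.coeff_C, hs, if_pos, zero_add, m1, m0]
      field_simp
      push_cast
      ring
    · simp only [map_add, map_sub, coeff_succ_X_mul, coeff_zero_X_mul, PowerSeries.coeff_C_mul,
        coeff_derivative, hG, coeff_mk, PowerSeries.coeff_C, hs, hd, zero_add, Nat.reduceAdd,
        m1, m2, one_ne_zero, if_false]
      field_simp
      push_cast
      ring
    · have h := dyckMoment_recurrence hℓ m
      simp only [map_add, map_sub, coeff_succ_X_mul, PowerSeries.coeff_C_mul,
        coeff_derivative, hG, coeff_mk, PowerSeries.coeff_C]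
      rw [if_neg (by omega)]
      push_cast
      rw [hs, hd] at *
      linear_combination 2 * h
  have hY : (1 - X) * H ^ 2 = PowerSeries.C s - PowerSeries.C d * X := by
    set Y := (1 - X) * H ^ 2 with hYdef
    have hY' : PowerSeries.C s * derivative ℝ Y - X * (PowerSeries.C d * derivative ℝ Y) +
        PowerSeries.C d * Y = 0 := by
      have e : derivative ℝ Y = - H ^ 2 + 2 * (1 - X) * H * derivative ℝ H := by
        rw [hYdef, Derivation.leibniz, Derivation.leibniz_pow, map_sub]
        simp
        ring
      have e4 : PowerSeries.C s - PowerSeries.C d = 2 * PowerSeries.C (2 * ℓ) := by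
        rw [← map_ofNat (PowerSeries.C (R := ℝ)) 2, ← map_mul, ← map_sub]
        congr 1
        rw [hs, hd]
        ring
      rw [e, hYdef]
      linear_combination 2 * H * hode - H ^ 2 * e4
    have hc : ∀ n, s * ((n + 1) * coeff (n + 1) Y) = d * ((n - 1) * coeff n Y) := by
      intro n
      have h := congrArg (coeff n) hY'
      rcases n with _ | n
      · simp only [map_add, map_sub, PowerSeries.coeff_C_mul, coeff_derivative, map_zero,
          coeff_zero_X_mul] at h
        push_cast at h ⊢
        linear_combination h
      · simp only [map_add, map_sub, PowerSeries.coeff_C_mul, coeff_derivative, map_zero,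
          coeff_succ_X_mul] at h
        push_cast at h ⊢
        linear_combination h
    have hc0 : coeff 0 Y = s := by
      simp [hYdef, hH, hG, dyckMoment, hs]
      ring
    have hc1 : coeff 1 Y = -d := by
      have h := hc 0
      rw [hc0] at h
      push_cast at h
      exact mul_left_cancel₀ hs0 (by linear_combination h)
    have hc2 : ∀ n, coeff (n + 2) Y = 0 := by
      intro n
      induction n with
      | zero =>
        have h := hc 1
        push_cast at h
        exact mul_left_cancel₀ hs0 (by linear_combination (1 / 2) * h)
      | succ n ih =>
        have h := hc (n + 2)
        rw [ih, mul_zero, mul_zero] at h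
        push_cast at h
        have : (n : ℝ) + 2 + 1 ≠ 0 := by positivity
        simpa [hs0, this] using h
    ext n
    rcases n with _ | _ | n
    · simpa using hc0
    · simpa [PowerSeries.coeff_C] using hc1
    · rw [hc2]
      simp
  have h4 : PowerSeries.C (4 : ℝ) ≠ 0 := by
    rw [Ne, ← map_zero (PowerSeries.C (R := ℝ)), (PowerSeries.C_injective).eq_iff]
    norm_num
  refine mul_left_cancel₀ h4 ?_
  have e4 : PowerSeries.C s - PowerSeries.C d = PowerSeries.C (4 : ℝ) * PowerSeries.C ℓ := by
    rw [← map_mul, ← map_sub]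
    congr 1
    rw [hs, hd]
    ring
  have e5 : PowerSeries.C d = PowerSeries.C (ℓ - 1) ^ 2 := by rw [hd, map_pow]
  have e6 : PowerSeries.C (4 : ℝ) = PowerSeries.C (2 : ℝ) ^ 2 := by rw [← map_pow]; norm_num
  have e7 : PowerSeries.C (2 : ℝ) = 2 := map_ofNat _ 2
  rw [← e4]
  rw [hH] at hY
  rw [e6]
  linear_combination hY + (1 - X) * PowerSeries.C 2 * PowerSeries.C (ℓ - 1) * G * e7 +
    (1 - X) * e5

theorem dyckMoment_convolution {ℓ : ℝ} (hℓ : 0 < ℓ) (n : ℕ) :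
    ∑ r ∈ Finset.range (n + 2), dyckMoment ℓ r * dyckMoment ℓ (n + 1 - r) +
        (ℓ - 1) * dyckMoment ℓ (n + 1) =
      ∑ r ∈ Finset.range (n + 1), dyckMoment ℓ r * dyckMoment ℓ (n - r) +
        (ℓ - 1) * dyckMoment ℓ n := by
  have h := congrArg (PowerSeries.coeff (n + 1)) (dyckMoment_generating_eq hℓ)
  generalize ℓ - 1 = c at h ⊢
  rw [sub_mul, one_mul] at h
  simp only [map_sub, map_add, PowerSeries.coeff_succ_X_mul, PowerSeries.coeff_C_mul,
    PowerSeries.coeff_mk, PowerSeries.coeff_C] at h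
  rw [if_neg (by omega)] at h
  simp only [pow_two, PowerSeries.coeff_mul, PowerSeries.coeff_mk,
    Finset.Nat.sum_antidiagonal_eq_sum_range_succ_mk] at h
  exact sub_eq_zero.1 h

/-- Unnormalised Jacobi weight on `[0,1]`. -/
noncomputable def jacobiWeight (a b t : ℝ) : ℝ := t ^ (a - 1) * (1 - t) ^ (b - 1)

theorem integrableOn_pow_mul_jacobiWeight {a b : ℝ} (ha : 0 < a) (hb : 0 < b) (d : ℕ) :
    IntegrableOn (fun t => t ^ d * jacobiWeight a b t) (Set.Icc 0 1) := by
  have h0 : IntegrableOn (jacobiWeight a b) (Set.Icc 0 1) := by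
    have h := Complex.betaIntegral_convergent (u := a) (v := b) (by simpa) (by simpa)
    rw [intervalIntegrable_iff_integrableOn_Ioc_of_le zero_le_one] at h
    rw [integrableOn_Icc_iff_integrableOn_Ioc]
    refine IntegrableOn.congr_fun h.re (fun t ht => ?_) measurableSet_Ioc
    simp only [jacobiWeight]
    have h1 : (1 : ℂ) - (t : ℂ) = ((1 - t : ℝ) : ℂ) := by push_cast; ring
    have h2 : (a : ℂ) - 1 = ((a - 1 : ℝ) : ℂ) := by push_cast; ring
    have h3 : (b : ℂ) - 1 = ((b - 1 : ℝ) : ℂ) := by push_cast; ring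
    rw [h1, h2, h3, ← Complex.ofReal_cpow ht.1.le, ← Complex.ofReal_cpow (by linarith [ht.2]),
      ← Complex.ofReal_mul]
    rfl
  exact h0.continuousOn_mul (by fun_prop) isCompact_Icc

/-- Moments of the Jacobi weight. -/
noncomputable def jacobiMoment (a b : ℝ) (d : ℕ) : ℝ :=
  ∫ t in Set.Icc (0 : ℝ) 1, t ^ d * jacobiWeight a b t

theorem jacobiMoment_recurrence {a b : ℝ} (ha : 0 < a) (hb : 0 < b) (d : ℕ) :
    (a + d) * jacobiMoment a b d = (a + b + d) * jacobiMoment a b (d + 1) := by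
  have hi := integrableOn_pow_mul_jacobiWeight ha hb
  have hd : ∀ t ∈ Set.Ioo (0 : ℝ) 1,
      HasDerivAt (fun t : ℝ => t ^ (a + d) * (1 - t) ^ b)
        ((a + d) * (t ^ d * jacobiWeight a b t) -
          (a + b + d) * (t ^ (d + 1) * jacobiWeight a b t)) t := by
    intro t ht
    have ht0 : t ≠ 0 := ht.1.ne'
    have ht1 : 1 - t ≠ 0 := by linarith [ht.2]
    have h1 : HasDerivAt (fun t : ℝ => t ^ (a + d)) _ t :=
      Real.hasDerivAt_rpow_const (Or.inl ht0)
    have h2 : HasDerivAt (fun t : ℝ => (1 - t) ^ b) _ t :=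
      ((hasDerivAt_id t).const_sub 1).rpow_const (Or.inl ht1)
    refine (h1.mul h2).congr_deriv ?_
    have e1 : t ^ (a + d) = t ^ (a - 1) * t ^ d * t := by
      rw [← Real.rpow_natCast, ← Real.rpow_add ht.1, ← Real.rpow_add_one ht0]; congr 1; ring
    have e2 : t ^ (a + d - 1) = t ^ (a - 1) * t ^ d := by
      rw [← Real.rpow_natCast, ← Real.rpow_add ht.1]; congr 1; ring
    have e3 : (1 - t) ^ b = (1 - t) ^ (b - 1) * (1 - t) := by
      rw [← Real.rpow_add_one ht1]; congr 1; ring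
    simp only [id, jacobiWeight]
    rw [e1, e2, e3]
    ring
  have hi' : IntegrableOn (fun t => (a + d) * (t ^ d * jacobiWeight a b t) -
      (a + b + d) * (t ^ (d + 1) * jacobiWeight a b t)) (Set.Icc 0 1) :=
    ((hi d).const_mul _).sub ((hi (d + 1)).const_mul _)
  have h := intervalIntegral.integral_eq_sub_of_hasDerivAt_of_le zero_le_one
    (f := fun t : ℝ => t ^ (a + d) * (1 - t) ^ b) (by
      refine ContinuousOn.mul ?_ ?_
      · exact ContinuousOn.rpow_const (by fun_prop) fun x _ => Or.inr (by positivity)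
      · exact ContinuousOn.rpow_const (by fun_prop) fun x _ => Or.inr hb.le) hd
    ((intervalIntegrable_iff_integrableOn_Icc_of_le zero_le_one).2 hi')
  rw [intervalIntegral.integral_of_le zero_le_one, ← integral_Icc_eq_integral_Ioc,
    integral_sub ((hi d).const_mul _) ((hi (d + 1)).const_mul _), integral_const_mul,
    integral_const_mul, Real.zero_rpow (by positivity), sub_self, Real.zero_rpow hb.ne'] at h
  simp only [mul_zero, zero_mul, sub_zero] at h
  exact sub_eq_zero.1 h

open MvPolynomial

/-- The integral of a polynomial against the product Jacobi weight on the unit cube. -/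
noncomputable def jacobiIntegral (N : ℕ) (a b : ℝ) (Q : MvPolynomial (Fin N) ℝ) : ℝ :=
  ∫ x in Set.univ.pi (fun _ : Fin N => Set.Icc (0 : ℝ) 1),
    eval x Q * ∏ i, jacobiWeight a b (x i)

theorem eval_monomial_mul_prod_jacobiWeight {N : ℕ} (a b c : ℝ) (d : Fin N →₀ ℕ)
    (x : Fin N → ℝ) :
    eval x (monomial d c) * ∏ i, jacobiWeight a b (x i) =
      c * ∏ i, (x i ^ d i * jacobiWeight a b (x i)) := by
  rw [eval_monomial, Finsupp.prod_fintype _ _ (by simp), Finset.prod_mul_distrib, mul_assoc]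

theorem volume_restrict_cube (N : ℕ) :
    (volume : Measure (Fin N → ℝ)).restrict (Set.univ.pi fun _ => Set.Icc (0 : ℝ) 1) =
      Measure.pi fun _ => volume.restrict (Set.Icc (0 : ℝ) 1) := by
  rw [volume_pi, Measure.restrict_pi_pi]

theorem integrableOn_eval_mul_prod_jacobiWeight {N : ℕ} {a b : ℝ} (ha : 0 < a) (hb : 0 < b)
    (Q : MvPolynomial (Fin N) ℝ) :
    IntegrableOn (fun x => eval x Q * ∏ i, jacobiWeight a b (x i))
      (Set.univ.pi fun _ : Fin N => Set.Icc (0 : ℝ) 1) := by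
  induction Q using MvPolynomial.induction_on' with
  | monomial d c =>
    simp only [eval_monomial_mul_prod_jacobiWeight]
    rw [IntegrableOn, volume_restrict_cube]
    exact (Integrable.fintype_prod (f := fun i t => t ^ d i * jacobiWeight a b t)
      fun i => integrableOn_pow_mul_jacobiWeight ha hb (d i)).const_mul c
  | add p q hp hq =>
    simp only [eval_add, add_mul]
    exact hp.add hq

theorem jacobiIntegral_monomial {N : ℕ} (a b c : ℝ) (d : Fin N →₀ ℕ) :
    jacobiIntegral N a b (monomial d c) = c * ∏ i, jacobiMoment a b (d i) := by
  simp only [jacobiIntegral, eval_monomial_mul_prod_jacobiWeight]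
  rw [integral_const_mul, volume_restrict_cube,
    integral_fintype_prod_eq_prod (f := fun i t => t ^ d i * jacobiWeight a b t)]
  rfl

theorem jacobiIntegral_add {N : ℕ} {a b : ℝ} (ha : 0 < a) (hb : 0 < b)
    (P Q : MvPolynomial (Fin N) ℝ) :
    jacobiIntegral N a b (P + Q) = jacobiIntegral N a b P + jacobiIntegral N a b Q := by
  simp only [jacobiIntegral, eval_add, add_mul]
  exact integral_add (integrableOn_eval_mul_prod_jacobiWeight ha hb P)
    (integrableOn_eval_mul_prod_jacobiWeight ha hb Q)

theorem jacobiIntegral_smul {N : ℕ} (a b c : ℝ) (Q : MvPolynomial (Fin N) ℝ) :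
    jacobiIntegral N a b (c • Q) = c * jacobiIntegral N a b Q := by
  simp only [jacobiIntegral, smul_eval, mul_assoc]
  exact integral_const_mul _ _

/-- The integral against the product Jacobi weight as a linear functional on polynomials. -/
noncomputable def jacobiFunctional (N : ℕ) {a b : ℝ} (ha : 0 < a) (hb : 0 < b) :
    MvPolynomial (Fin N) ℝ →ₗ[ℝ] ℝ where
  toFun := jacobiIntegral N a b
  map_add' := jacobiIntegral_add ha hb
  map_smul' c Q := jacobiIntegral_smul a b c Q

theorem jacobiWeight_nonneg {a b t : ℝ} (ht : t ∈ Set.Icc (0 : ℝ) 1) : 0 ≤ jacobiWeight a b t :=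
  mul_nonneg (Real.rpow_nonneg ht.1 _) (Real.rpow_nonneg (by linarith [ht.2]) _)

theorem jacobiFunctional_nonneg {N : ℕ} {a b : ℝ} (ha : 0 < a) (hb : 0 < b)
    {Q : MvPolynomial (Fin N) ℝ}
    (hQ : ∀ x : Fin N → ℝ, (∀ i, x i ∈ Set.Icc (0 : ℝ) 1) → 0 ≤ eval x Q) :
    0 ≤ jacobiFunctional N ha hb Q := by
  refine setIntegral_nonneg (MeasurableSet.univ_pi fun _ => measurableSet_Icc) fun x hx => ?_
  rw [Set.mem_univ_pi] at hx
  exact mul_nonneg (hQ x hx) (Finset.prod_nonneg fun i _ => jacobiWeight_nonneg (hx i))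

/-- One-variable integration by parts against the Jacobi weight. -/
theorem jacobiFunctional_pderiv {N : ℕ} {a b : ℝ} (ha : 0 < a) (hb : 0 < b) (i : Fin N)
    (Q : MvPolynomial (Fin N) ℝ) :
    jacobiFunctional N ha hb
      ((X i - X i ^ 2) * pderiv i Q + (C a * (1 - X i) - C b * X i) * Q) = 0 := by
  induction Q using MvPolynomial.induction_on' with
  | monomial d c =>
    have h1 : (X i - X i ^ 2) * pderiv i (monomial d c) +
        (C a * (1 - X i) - C b * X i) * monomial d c =
        (a + d i) • monomial d c - (a + b + d i) • monomial (d + Finsupp.single i 1) c := by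
      have hX : X i * pderiv i (monomial d c) = _ := X_mul_pderiv_monomial
      have hs : monomial (d + Finsupp.single i 1) c = (monomial d c : MvPolynomial (Fin N) ℝ) * X i := by
        rw [X, monomial_mul, mul_one]
      rw [hs, show (X i - X i ^ 2 : MvPolynomial (Fin N) ℝ) * pderiv i (monomial d c) =
        (1 - X i) * (X i * pderiv i (monomial d c)) by ring, hX]
      simp only [smul_eq_C_mul, nsmul_eq_mul, map_add, map_natCast]
      ring
    rw [h1, map_sub, map_smul, map_smul]
    change (a + d i) * jacobiIntegral N a b _ - (a + b + d i) * jacobiIntegral N a b _ = 0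
    rw [jacobiIntegral_monomial, jacobiIntegral_monomial,
      ← Finset.mul_prod_erase _ _ (Finset.mem_univ i),
      ← Finset.mul_prod_erase _ _ (Finset.mem_univ i)]
    have h2 : ∏ j ∈ Finset.univ.erase i, jacobiMoment a b ((d + Finsupp.single i 1 : Fin N →₀ ℕ) j) =
        ∏ j ∈ Finset.univ.erase i, jacobiMoment a b (d j) := by
      refine Finset.prod_congr rfl fun j hj => ?_
      rw [Finsupp.add_apply, Finsupp.single_eq_of_ne (Finset.ne_of_mem_erase hj), add_zero]
    rw [h2, Finsupp.add_apply, Finsupp.single_eq_same]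
    linear_combination c * (∏ j ∈ Finset.univ.erase i, jacobiMoment a b (d j)) *
      jacobiMoment_recurrence ha hb (d i)
  | add p q hp hq =>
    rw [← add_zero (0 : ℝ)]
    nth_rewrite 1 [← hp]
    rw [← hq, ← map_add]
    congr 1
    rw [map_add]
    ring

theorem mkDerivation_eq_sum_pderiv {N : ℕ} (f : Fin N → MvPolynomial (Fin N) ℝ)
    (G : MvPolynomial (Fin N) ℝ) : mkDerivation ℝ f G = ∑ i, f i * pderiv i G := by
  have hs : ∀ Q, (∑ i, f i • pderiv (R := ℝ) i) Q = ∑ i, f i * pderiv i Q := fun Q => by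
    refine (congrFun (map_sum (Derivation.coeFnAddMonoidHom (R := ℝ)
      (A := MvPolynomial (Fin N) ℝ) (M := MvPolynomial (Fin N) ℝ)) _ _) Q).trans ?_
    rw [Finset.sum_apply]
    rfl
  have h : mkDerivation ℝ f = ∑ i, f i • pderiv (R := ℝ) i := by
    refine derivation_ext fun j => ?_
    rw [mkDerivation_X, hs, Finset.sum_eq_single j]
    · simp
    · intro i _ hij
      simp [pderiv_X_of_ne hij.symm]
    · simp
  rw [h, hs]

/-- The derivation of the polynomial ring along the vector field `(xᵢⁿ⁺¹ (1 - xᵢ))ᵢ`. -/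
noncomputable def powDerivation (N n : ℕ) :
    Derivation ℝ (MvPolynomial (Fin N) ℝ) (MvPolynomial (Fin N) ℝ) :=
  mkDerivation ℝ fun i => X i ^ (n + 1) - X i ^ (n + 2)

theorem jacobiFunctional_powDerivation {N : ℕ} {a b : ℝ} (ha : 0 < a) (hb : 0 < b) (n : ℕ)
    (G : MvPolynomial (Fin N) ℝ) :
    jacobiFunctional N ha hb (powDerivation N n G +
      (C (a + n) * psum (Fin N) ℝ n - C (a + b + n) * psum (Fin N) ℝ (n + 1)) * G) = 0 := by
  have h : ∀ i : Fin N, jacobiFunctional N ha hb ((X i ^ (n + 1) - X i ^ (n + 2)) * pderiv i G +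
      (C (a + n) * X i ^ n - C (a + b + n) * X i ^ (n + 1)) * G) = 0 := by
    intro i
    rw [← jacobiFunctional_pderiv ha hb i (X i ^ n * G)]
    congr 1
    rw [pderiv_mul, pderiv_pow, pderiv_X_self]
    simp only [map_add, map_natCast]
    rcases n with _ | n
    · push_cast
      ring
    · simp only [Nat.add_sub_cancel]
      push_cast
      ring
  rw [← Finset.sum_const_zero (s := (Finset.univ : Finset (Fin N))),
    ← Finset.sum_congr rfl fun i _ => h i, ← map_sum]
  congr 1
  rw [powDerivation, mkDerivation_eq_sum_pderiv, Finset.sum_add_distrib, ← Finset.sum_mul,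
    Finset.sum_sub_distrib, ← Finset.mul_sum, ← Finset.mul_sum]
  rfl

/-- The squared Vandermonde polynomial. -/
noncomputable def vandermondeSq (N : ℕ) : MvPolynomial (Fin N) ℝ :=
  ∏ i, ∏ j ∈ Finset.Ioi i, (X i - X j) ^ 2

theorem Derivation.map_prod_of_map_eq_mul {R A ι : Type*} [CommRing R] [CommRing A] [Algebra R A]
    (D : Derivation R A A) (s : Finset ι) {f g : ι → A} (h : ∀ i ∈ s, D (f i) = f i * g i) :
    D (∏ i ∈ s, f i) = (∏ i ∈ s, f i) * ∑ i ∈ s, g i := by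
  classical
  induction s using Finset.induction_on with
  | empty => simp
  | insert i s hi ih =>
    rw [Finset.prod_insert hi, Finset.sum_insert hi, Derivation.leibniz,
      ih fun j hj => h j (Finset.mem_insert_of_mem hj), h i (Finset.mem_insert_self i s)]
    simp only [smul_eq_mul]
    ring

theorem two_mul_sum_Ioi_geom_sum {N : ℕ} (n : ℕ) :
    2 * ∑ i : Fin N, ∑ j ∈ Finset.Ioi i, ∑ r ∈ Finset.range n,
      (X i ^ r * X j ^ (n - 1 - r) : MvPolynomial (Fin N) ℝ) =
    ∑ r ∈ Finset.range n, psum (Fin N) ℝ r * psum (Fin N) ℝ (n - 1 - r) -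
      n * psum (Fin N) ℝ (n - 1) := by
  set h : Fin N → Fin N → MvPolynomial (Fin N) ℝ := fun i j =>
    ∑ r ∈ Finset.range n, X i ^ r * X j ^ (n - 1 - r) with hh
  have hsymm : ∀ i j, h i j = h j i := by
    intro i j
    simp only [hh]
    rw [← Finset.sum_range_reflect]
    refine Finset.sum_congr rfl fun r hr => ?_
    have := Finset.mem_range.1 hr
    rw [mul_comm, show n - 1 - (n - 1 - r) = r by omega]
  have h1 := Finset.sum_sum_Ioi_add_eq_sum_sum_off_diag h
  have h2 : ∑ i, ∑ j, h j i =
      ∑ r ∈ Finset.range n, psum (Fin N) ℝ r * psum (Fin N) ℝ (n - 1 - r) := by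
    simp only [psum, Finset.sum_mul_sum, hh]
    rw [Finset.sum_comm' (t' := Finset.univ) (s' := fun _ => Finset.univ) (by simp)]
    simp_rw [Finset.sum_comm (t := Finset.range n)]
  have h3 : ∑ i, h i i = n * psum (Fin N) ℝ (n - 1) := by
    simp only [psum, hh]
    rw [Finset.mul_sum]
    refine Finset.sum_congr rfl fun i _ => ?_
    rw [← nsmul_eq_mul, ← Finset.card_range n, ← Finset.sum_const, Finset.card_range]
    refine Finset.sum_congr rfl fun r hr => ?_
    have := Finset.mem_range.1 hr
    rw [← pow_add]
    congr 1
    omega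
  rw [← h2, ← h3, ← Finset.sum_sub_distrib]
  change 2 * ∑ i, ∑ j ∈ Finset.Ioi i, h i j = _
  have h4 : ∀ i, ∑ j, h j i - h i i = ∑ j ∈ {i}ᶜ, h j i := by
    intro i
    rw [← Finset.sum_compl_add_sum {i} (fun j => h j i)]
    simp
  simp only [h4, ← h1, Finset.mul_sum]
  refine Finset.sum_congr rfl fun i _ => Finset.sum_congr rfl fun j _ => ?_
  rw [hsymm j i, two_mul]

theorem powDerivation_vandermondeSq (N n : ℕ) :
    powDerivation N n (vandermondeSq N) = vandermondeSq N *
      ((∑ r ∈ Finset.range (n + 1), psum (Fin N) ℝ r * psum (Fin N) ℝ (n - r) -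
        (n + 1) * psum (Fin N) ℝ n) -
      (∑ r ∈ Finset.range (n + 2), psum (Fin N) ℝ r * psum (Fin N) ℝ (n + 1 - r) -
        (n + 2) * psum (Fin N) ℝ (n + 1))) := by
  set g : ℕ → Fin N → Fin N → MvPolynomial (Fin N) ℝ := fun m i j =>
    ∑ r ∈ Finset.range m, X i ^ r * X j ^ (m - 1 - r) with hg
  have hD : ∀ i j : Fin N, powDerivation N n ((X i - X j) ^ 2) =
      (X i - X j) ^ 2 * (2 * g (n + 1) i j - 2 * g (n + 2) i j) := by
    intro i j
    have e : ∀ m, g m i j * (X i - X j) = X i ^ m - X j ^ m := fun m =>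
      (Commute.all _ _).geom_sum₂_mul m
    rw [Derivation.leibniz_pow, map_sub, powDerivation, mkDerivation_X, mkDerivation_X]
    simp only [smul_eq_mul, nsmul_eq_mul]
    push_cast
    linear_combination 2 * (X i - X j) * (e (n + 2) - e (n + 1))
  have h1 : powDerivation N n (vandermondeSq N) = vandermondeSq N *
      ∑ i, ∑ j ∈ Finset.Ioi i, (2 * g (n + 1) i j - 2 * g (n + 2) i j) :=
    Derivation.map_prod_of_map_eq_mul _ _ fun i _ =>
      Derivation.map_prod_of_map_eq_mul _ _ fun j _ => hD i j
  have e1 := two_mul_sum_Ioi_geom_sum (N := N) (n + 1)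
  have e2 := two_mul_sum_Ioi_geom_sum (N := N) (n + 2)
  push_cast at e1 e2
  rw [h1, ← e1, ← e2]
  simp only [Finset.sum_sub_distrib, Finset.mul_sum, hg]
  rfl

theorem jacobiFunctional_loop {N : ℕ} {a b : ℝ} (ha : 0 < a) (hb : 0 < b) (n : ℕ)
    (F : MvPolynomial (Fin N) ℝ) :
    jacobiFunctional N ha hb (vandermondeSq N * (powDerivation N n F + F *
      (∑ r ∈ Finset.range (n + 1), psum (Fin N) ℝ r * psum (Fin N) ℝ (n - r) -
        ∑ r ∈ Finset.range (n + 2), psum (Fin N) ℝ r * psum (Fin N) ℝ (n + 1 - r) +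
        C (a - 1) * psum (Fin N) ℝ n - C (a + b - 2) * psum (Fin N) ℝ (n + 1)))) = 0 := by
  rw [← jacobiFunctional_powDerivation ha hb n (vandermondeSq N * F)]
  congr 1
  rw [Derivation.leibniz, powDerivation_vandermondeSq]
  simp only [smul_eq_mul, map_add, map_sub, map_natCast, map_one, map_ofNat]
  ring

theorem eval_vandermondeSq {N : ℕ} (x : Fin N → ℝ) :
    eval x (vandermondeSq N) = ∏ i, ∏ j ∈ Finset.Ioi i, (x i - x j) ^ 2 := by
  simp [vandermondeSq, map_prod]

theorem eval_vandermondeSq_nonneg {N : ℕ} (x : Fin N → ℝ) : 0 ≤ eval x (vandermondeSq N) := by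
  rw [eval_vandermondeSq]
  positivity

theorem jacobiFunctional_vandermondeSq_pos {N : ℕ} {a b : ℝ} (ha : 0 < a) (hb : 0 < b) :
    0 < jacobiFunctional N ha hb (vandermondeSq N) := by
  have hm : MeasurableSet (Set.univ.pi fun _ : Fin N => Set.Icc (0 : ℝ) 1) :=
    MeasurableSet.univ_pi fun _ => measurableSet_Icc
  change 0 < jacobiIntegral N a b _
  rw [jacobiIntegral, setIntegral_pos_iff_support_of_nonneg_ae _
    (integrableOn_eval_mul_prod_jacobiWeight ha hb _)]
  · set U : Set (Fin N → ℝ) :=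
      (Set.univ.pi fun _ : Fin N => Set.Ioo (0 : ℝ) 1) ∩ {x | eval x (vandermondeSq N) ≠ 0}
    have hU : IsOpen U := (isOpen_set_pi Set.finite_univ fun _ _ => isOpen_Ioo).inter
      (isOpen_ne_fun (continuous_eval _) continuous_const)
    have hne : U.Nonempty := by
      refine ⟨fun i => ((i : ℕ) + 1) / ((N : ℝ) + 1), ?_, ?_⟩
      · intro i _
        have : ((i : ℕ) : ℝ) < N := by exact_mod_cast i.2
        refine ⟨by positivity, ?_⟩
        rw [div_lt_one (by positivity)]
        linarith
      · rw [Set.mem_ofPred_eq, eval_vandermondeSq, Finset.prod_ne_zero_iff]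
        intro i _
        rw [Finset.prod_ne_zero_iff]
        intro j hj
        have hij : ((i : ℕ) : ℝ) < ((j : ℕ) : ℝ) := by
          exact_mod_cast Finset.mem_Ioi.1 hj
        refine pow_ne_zero 2 (ne_of_lt ?_)
        rw [sub_neg]
        gcongr
    refine (hU.measure_pos volume hne).trans_le (measure_mono fun x hx => ⟨?_, ?_⟩)
    · refine mul_ne_zero hx.2 (Finset.prod_ne_zero_iff.2 fun i _ => ?_)
      have := hx.1 i (Set.mem_univ i)
      exact mul_ne_zero (Real.rpow_pos_of_pos this.1 _).ne'
        (Real.rpow_pos_of_pos (by linarith [this.2]) _).ne'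
    · exact fun i _ => Set.Ioo_subset_Icc_self (hx.1 i (Set.mem_univ i))
  · refine (ae_restrict_iff' hm).2 (Filter.Eventually.of_forall fun x hx => ?_)
    rw [Set.mem_univ_pi] at hx
    exact mul_nonneg (eval_vandermondeSq_nonneg x)
      (Finset.prod_nonneg fun i _ => jacobiWeight_nonneg (hx i))

/-- The normalised expectation of a polynomial in the Jacobi ensemble. -/
noncomputable def jacobiExpectation (N : ℕ) {a b : ℝ} (ha : 0 < a) (hb : 0 < b) :
    MvPolynomial (Fin N) ℝ →ₗ[ℝ] ℝ :=
  (jacobiFunctional N ha hb (vandermondeSq N))⁻¹ •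
    (jacobiFunctional N ha hb ∘ₗ LinearMap.mulLeft ℝ (vandermondeSq N))

theorem jacobiExpectation_apply {N : ℕ} {a b : ℝ} (ha : 0 < a) (hb : 0 < b)
    (Q : MvPolynomial (Fin N) ℝ) : jacobiExpectation N ha hb Q =
      (jacobiFunctional N ha hb (vandermondeSq N))⁻¹ *
        jacobiFunctional N ha hb (vandermondeSq N * Q) := rfl

theorem jacobiExpectation_one {N : ℕ} {a b : ℝ} (ha : 0 < a) (hb : 0 < b) :
    jacobiExpectation N ha hb 1 = 1 := by
  rw [jacobiExpectation_apply, mul_one,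
    inv_mul_cancel₀ (jacobiFunctional_vandermondeSq_pos ha hb).ne']

theorem jacobiExpectation_nonneg {N : ℕ} {a b : ℝ} (ha : 0 < a) (hb : 0 < b)
    {Q : MvPolynomial (Fin N) ℝ}
    (hQ : ∀ x : Fin N → ℝ, (∀ i, x i ∈ Set.Icc (0 : ℝ) 1) → 0 ≤ eval x Q) :
    0 ≤ jacobiExpectation N ha hb Q := by
  rw [jacobiExpectation_apply]
  refine mul_nonneg (inv_nonneg.2 (jacobiFunctional_vandermondeSq_pos ha hb).le)
    (jacobiFunctional_nonneg ha hb fun x hx => ?_)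
  rw [eval_mul]
  exact mul_nonneg (eval_vandermondeSq_nonneg x) (hQ x hx)

theorem Ik_eq_jacobiExpectation_psum {N : ℕ} {a b : ℝ} (ha : 0 < a) (hb : 0 < b) (k : ℕ) :
    Ik k N a b = jacobiExpectation N ha hb (psum (Fin N) ℝ k) := by
  have hf : (N.factorial : ℝ) ≠ 0 := by exact_mod_cast N.factorial_ne_zero
  have h : ∀ Q : MvPolynomial (Fin N) ℝ, jacobiAvg N a b (fun x => eval x Q) =
      (N.factorial : ℝ)⁻¹ * jacobiFunctional N ha hb (vandermondeSq N * Q) := by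
    intro Q
    change _ = _ * jacobiIntegral N a b _
    rw [jacobiAvg, jacobiIntegral]
    congr 2
    funext x
    rw [eval_mul, eval_vandermondeSq, mul_comm (eval x Q)]
    rfl
  have h1 := h 1
  have h2 := h (psum (Fin N) ℝ k)
  simp only [map_one, mul_one] at h1
  simp only [psum, map_sum, map_pow, eval_X] at h2
  rw [Ik, h1, h2, jacobiExpectation_apply, mul_div_mul_left _ _ (inv_ne_zero hf), div_eq_inv_mul]
  rfl

/-- Sequences whose `N`-th term is a polynomial in `N + 1` variables. -/
abbrev PolynomialSeq : Type := ∀ N : ℕ, MvPolynomial (Fin (N + 1)) ℝ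

/-- The sequences of polynomials that are uniformly bounded on the unit cubes. -/
noncomputable def cubeBounded : Subalgebra ℝ PolynomialSeq where
  carrier := {f | ∃ K : ℝ, ∀ N, ∀ x : Fin (N + 1) → ℝ,
    (∀ i, x i ∈ Set.Icc (0 : ℝ) 1) → |eval x (f N)| ≤ K}
  mul_mem' := by
    rintro f g ⟨K, hK⟩ ⟨L, hL⟩
    refine ⟨K * L, fun N x hx => ?_⟩
    rw [Pi.mul_apply, eval_mul, abs_mul]
    exact mul_le_mul (hK N x hx) (hL N x hx) (abs_nonneg _) ((abs_nonneg _).trans (hK N x hx))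
  add_mem' := by
    rintro f g ⟨K, hK⟩ ⟨L, hL⟩
    refine ⟨K + L, fun N x hx => ?_⟩
    rw [Pi.add_apply, eval_add]
    exact (abs_add_le _ _).trans (add_le_add (hK N x hx) (hL N x hx))
  algebraMap_mem' := fun c => ⟨|c|, fun N x _ => by
    rw [Pi.algebraMap_apply, algebraMap_eq, eval_C]⟩

/-- A linear functional on polynomials that is normalised and nonnegative on polynomials which are
nonnegative on the unit cube. -/
structure IsCubeState {N : ℕ} (L : MvPolynomial (Fin N) ℝ →ₗ[ℝ] ℝ) : Prop where
  map_one : L 1 = 1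
  nonneg : ∀ Q, (∀ x : Fin N → ℝ, (∀ i, x i ∈ Set.Icc (0 : ℝ) 1) → 0 ≤ eval x Q) → 0 ≤ L Q

theorem IsCubeState.map_C {N : ℕ} {L : MvPolynomial (Fin N) ℝ →ₗ[ℝ] ℝ} (hL : IsCubeState L)
    (c : ℝ) : L (C c) = c := by
  rw [← mul_one (C c), ← smul_eq_C_mul, map_smul, hL.map_one, smul_eq_mul, mul_one]

theorem IsCubeState.mono {N : ℕ} {L : MvPolynomial (Fin N) ℝ →ₗ[ℝ] ℝ} (hL : IsCubeState L)
    {P Q : MvPolynomial (Fin N) ℝ}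
    (h : ∀ x : Fin N → ℝ, (∀ i, x i ∈ Set.Icc (0 : ℝ) 1) → eval x P ≤ eval x Q) : L P ≤ L Q := by
  rw [← sub_nonneg, ← map_sub]
  exact hL.nonneg _ fun x hx => by rw [eval_sub]; exact sub_nonneg.2 (h x hx)

theorem IsCubeState.sq_le {N : ℕ} {L : MvPolynomial (Fin N) ℝ →ₗ[ℝ] ℝ} (hL : IsCubeState L)
    (Q : MvPolynomial (Fin N) ℝ) : L Q ^ 2 ≤ L (Q ^ 2) := by
  have h := hL.nonneg ((Q - C (L Q)) ^ 2) fun x _ => by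
    rw [eval_pow]; positivity
  have e : (Q - C (L Q)) ^ 2 = Q ^ 2 - (2 * L Q) • Q + C (L Q ^ 2) := by
    rw [smul_eq_C_mul]
    simp only [map_mul, map_pow, map_ofNat]
    ring
  rw [e, map_add, map_sub, map_smul, hL.map_C, smul_eq_mul] at h
  linarith

/-- The sequences of polynomials which tend to zero in mean square. -/
noncomputable def meanSquareNull (E : ∀ N : ℕ, MvPolynomial (Fin (N + 1)) ℝ →ₗ[ℝ] ℝ)
    (hE : ∀ N, IsCubeState (E N)) : Submodule ℝ PolynomialSeq where
  carrier := {f | Filter.Tendsto (fun N => E N (f N ^ 2)) Filter.atTop (nhds 0)}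
  add_mem' := by
    intro f g hf hg
    refine squeeze_zero (g := fun N => 2 * E N (f N ^ 2) + 2 * E N (g N ^ 2))
      (fun N => (hE N).nonneg _ fun x _ => ?_) (fun N => ?_) ?_
    · rw [eval_pow]; positivity
    · have e : 2 * E N (f N ^ 2) + 2 * E N (g N ^ 2) =
          E N ((2 : ℝ) • f N ^ 2 + (2 : ℝ) • g N ^ 2) := by simp
      rw [e]
      refine (hE N).mono fun x _ => ?_
      simp only [Pi.add_apply, eval_add, eval_pow, smul_eval]
      nlinarith [sq_nonneg (eval x (f N) - eval x (g N))]
    · simpa using (hf.const_mul 2).add (hg.const_mul 2)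
  zero_mem' := by simp
  smul_mem' := by
    intro c f hf
    have e : ∀ N, E N ((c • f) N ^ 2) = c ^ 2 * E N (f N ^ 2) := fun N => by
      rw [Pi.smul_apply, smul_pow, map_smul, smul_eq_mul]
    change Filter.Tendsto _ _ _
    simp only [e]
    simpa using Filter.Tendsto.const_mul (c ^ 2) hf

section MeanSquare

variable {E : ∀ N : ℕ, MvPolynomial (Fin (N + 1)) ℝ →ₗ[ℝ] ℝ} {hE : ∀ N, IsCubeState (E N)}
  {f g : PolynomialSeq}

theorem mem_meanSquareNull :
    f ∈ meanSquareNull E hE ↔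
      Filter.Tendsto (fun N => E N (f N ^ 2)) Filter.atTop (nhds 0) := Iff.rfl

theorem tendsto_of_mem_meanSquareNull (hf : f ∈ meanSquareNull E hE) :
    Filter.Tendsto (fun N => E N (f N)) Filter.atTop (nhds 0) := by
  refine squeeze_zero_norm (a := fun N => Real.sqrt (E N (f N ^ 2))) (fun N => ?_) ?_
  · exact Real.abs_le_sqrt ((hE N).sq_le _)
  · simpa [Function.comp_def] using
      (Real.continuous_sqrt.tendsto 0).comp (mem_meanSquareNull.1 hf)

theorem mul_mem_meanSquareNull (hf : f ∈ meanSquareNull E hE) (hg : g ∈ cubeBounded) :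
    f * g ∈ meanSquareNull E hE := by
  obtain ⟨K, hK⟩ := hg
  refine squeeze_zero (g := fun N => K ^ 2 * E N (f N ^ 2))
      (fun N => (hE N).nonneg _ fun x _ => ?_) (fun N => ?_) ?_
  · rw [eval_pow]; positivity
  · rw [← smul_eq_mul (K ^ 2), ← map_smul]
    refine (hE N).mono fun x hx => ?_
    have h : eval x (g N) ^ 2 ≤ K ^ 2 := sq_le_sq.2 ((hK N x hx).trans (le_abs_self K))
    simp only [Pi.mul_apply, eval_mul, eval_pow, smul_eval]
    rw [mul_pow, mul_comm]
    gcongr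
  · simpa using (mem_meanSquareNull.1 hf).const_mul (K ^ 2)

end MeanSquare

/-- The constants `1 / (N + 1)`. -/
noncomputable def invSeq : PolynomialSeq := fun N => C ((N + 1 : ℝ)⁻¹)

/-- The normalised power sums. -/
noncomputable def psumSeq (r : ℕ) : PolynomialSeq :=
  fun N => C ((N + 1 : ℝ)⁻¹) * psum (Fin (N + 1)) ℝ r

theorem invSeq_mem_cubeBounded : invSeq ∈ cubeBounded := by
  refine ⟨1, fun N x _ => ?_⟩
  rw [invSeq, eval_C, abs_of_nonneg (by positivity)]
  exact inv_le_one_of_one_le₀ (by linarith [(Nat.cast_nonneg N : (0 : ℝ) ≤ N)])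

theorem psumSeq_mem_cubeBounded (r : ℕ) : psumSeq r ∈ cubeBounded := by
  refine ⟨1, fun N x hx => ?_⟩
  rw [psumSeq, eval_mul, eval_C, psum, map_sum]
  simp only [map_pow, eval_X]
  rw [abs_of_nonneg (mul_nonneg (by positivity)
    (Finset.sum_nonneg fun i _ => pow_nonneg (hx i).1 r)), inv_mul_le_one₀ (by positivity)]
  refine (Finset.sum_le_card_nsmul _ _ 1 fun i _ => pow_le_one₀ (hx i).1 (hx i).2).trans ?_
  simp

theorem invSeq_mem_meanSquareNull {E : ∀ N : ℕ, MvPolynomial (Fin (N + 1)) ℝ →ₗ[ℝ] ℝ}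
    (hE : ∀ N, IsCubeState (E N)) : invSeq ∈ meanSquareNull E hE := by
  rw [mem_meanSquareNull]
  have h : ∀ N, E N (invSeq N ^ 2) = (1 / ((N : ℝ) + 1)) ^ 2 := fun N => by
    rw [invSeq, ← map_pow, (hE N).map_C, one_div]
  simp only [h]
  simpa using (tendsto_one_div_add_atTop_nhds_zero_nat (𝕜 := ℝ)).pow 2

theorem psumSeq_zero : psumSeq 0 = 1 := by
  funext N
  have : (N + 1 : ℝ) ≠ 0 := by positivity
  rw [psumSeq, psum_zero, Fintype.card_fin, ← map_natCast (C (R := ℝ)), ← map_mul]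
  push_cast
  rw [inv_mul_cancel₀ this, map_one]
  rfl

theorem sum_range_succ_succ_eq_ends {R : Type*} [CommRing R] (f : ℕ → R) (n : ℕ) (h0 : f 0 = 1) :
    ∑ r ∈ Finset.range (n + 2), f r * f (n + 1 - r) =
      2 * f (n + 1) + ∑ r ∈ Finset.range n, f (r + 1) * f (n - r) := by
  rw [Finset.sum_range_succ, Finset.sum_range_succ']
  simp only [Nat.sub_self, Nat.sub_zero, h0, Nat.add_sub_add_right]
  ring

theorem isCubeState_jacobiExpectation {N : ℕ} {a b : ℝ} (ha : 0 < a) (hb : 0 < b) :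
    IsCubeState (jacobiExpectation N ha hb) :=
  ⟨jacobiExpectation_one ha hb, fun _ hQ => jacobiExpectation_nonneg ha hb hQ⟩

theorem jacobiExpectation_psumSeq_loop {N : ℕ} {a b : ℝ} (ha : 0 < a) (hb : 0 < b) (n : ℕ)
    (c : ℝ) :
    jacobiExpectation (N + 1) ha hb
      (invSeq N ^ 2 * (((n : MvPolynomial (Fin (N + 1)) ℝ) + 1) *
        (psumSeq (2 * n + 1) N - psumSeq (2 * n + 2) N)) +
      (psumSeq (n + 1) N - C c) *
      (∑ r ∈ Finset.range (n + 1), psumSeq r N * psumSeq (n - r) N -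
        ∑ r ∈ Finset.range (n + 2), psumSeq r N * psumSeq (n + 1 - r) N +
        C (a - 1) * invSeq N * psumSeq n N -
        C (a + b - 2) * invSeq N * psumSeq (n + 1) N)) = 0 := by
  have h := jacobiFunctional_loop ha hb n (psumSeq (n + 1) N - C c)
  have hD : powDerivation (N + 1) n (psumSeq (n + 1) N - C c) =
      ((n : MvPolynomial (Fin (N + 1)) ℝ) + 1) *
        (psumSeq (2 * n + 1) N - psumSeq (2 * n + 2) N) := by
    simp only [psumSeq, psum]
    rw [map_sub, derivation_C, sub_zero, ← smul_eq_C_mul, Derivation.map_smul, map_sum, smul_eq_C_mul,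
      ← mul_sub, ← Finset.sum_sub_distrib, mul_left_comm]
    congr 1
    rw [Finset.mul_sum]
    refine Finset.sum_congr rfl fun i _ => ?_
    rw [Derivation.leibniz_pow, powDerivation, mkDerivation_X]
    simp only [smul_eq_mul, nsmul_eq_mul, Nat.add_sub_cancel]
    push_cast
    ring
  rw [hD] at h
  rw [jacobiExpectation_apply]
  refine mul_eq_zero_of_right _ ?_
  have h2 := congrArg (fun y => ((N + 1 : ℝ)⁻¹ ^ 2) • y) h
  simp only [smul_zero] at h2
  rw [← map_smul] at h2
  rw [← h2, smul_eq_C_mul]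
  congr 1
  have e : ∀ m, ∑ r ∈ Finset.range m, psumSeq r N * psumSeq (m - 1 - r) N = C ((N + 1 : ℝ)⁻¹) ^ 2 *
      ∑ r ∈ Finset.range m, psum (Fin (N + 1)) ℝ r * psum (Fin (N + 1)) ℝ (m - 1 - r) := fun m => by
    rw [Finset.mul_sum]
    refine Finset.sum_congr rfl fun r _ => ?_
    simp only [psumSeq]
    ring
  have e1 := e (n + 1)
  have e2 := e (n + 2)
  simp only [Nat.add_sub_cancel, show n + 2 - 1 = n + 1 from rfl] at e1 e2
  rw [e1, e2, map_pow]
  simp only [invSeq]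
  generalize hp : psumSeq (2 * n + 1) N - psumSeq (2 * n + 2) N = p
  simp only [psumSeq]
  ring

section Asymptotics

variable {E : ∀ N : ℕ, MvPolynomial (Fin (N + 1)) ℝ →ₗ[ℝ] ℝ} {hE : ∀ N, IsCubeState (E N)}
  {c : ℕ → ℝ}

theorem mul_psumSeq_sub_mem {r s : ℕ}
    (hr : psumSeq r - algebraMap ℝ PolynomialSeq (c r) ∈ meanSquareNull E hE)
    (hs : psumSeq s - algebraMap ℝ PolynomialSeq (c s) ∈ meanSquareNull E hE) :
    psumSeq r * psumSeq s - algebraMap ℝ PolynomialSeq (c r * c s) ∈ meanSquareNull E hE := by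
  have e : psumSeq r * psumSeq s - algebraMap ℝ PolynomialSeq (c r * c s) =
      (psumSeq r - algebraMap ℝ PolynomialSeq (c r)) * psumSeq s +
      (psumSeq s - algebraMap ℝ PolynomialSeq (c s)) * algebraMap ℝ PolynomialSeq (c r) := by
    rw [map_mul]
    ring
  rw [e]
  exact add_mem (mul_mem_meanSquareNull hr (psumSeq_mem_cubeBounded s))
    (mul_mem_meanSquareNull hs (Subalgebra.algebraMap_mem _ _))

theorem sum_mul_psumSeq_sub_mem (m : ℕ) (i j : ℕ → ℕ)
    (hi : ∀ r < m, psumSeq (i r) - algebraMap ℝ PolynomialSeq (c (i r)) ∈ meanSquareNull E hE)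
    (hj : ∀ r < m, psumSeq (j r) - algebraMap ℝ PolynomialSeq (c (j r)) ∈ meanSquareNull E hE) :
    ∑ r ∈ Finset.range m, psumSeq (i r) * psumSeq (j r) -
      algebraMap ℝ PolynomialSeq (∑ r ∈ Finset.range m, c (i r) * c (j r)) ∈
        meanSquareNull E hE := by
  rw [map_sum, ← Finset.sum_sub_distrib]
  exact sum_mem fun r hr => mul_psumSeq_sub_mem (hi r (Finset.mem_range.1 hr))
    (hj r (Finset.mem_range.1 hr))

end Asymptotics

theorem psumSeq_sub_dyckMoment_mem {ℓ a₀ b₀ : ℝ} (hℓ : 1 ≤ ℓ) (hb₀ : 0 < b₀)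
    (ha : ∀ N : ℕ, 0 < (ℓ - 1) * ((N : ℝ) + 1) + a₀)
    (hE : ∀ N : ℕ, IsCubeState (jacobiExpectation (N + 1) (ha N) hb₀)) (k : ℕ) :
    psumSeq k - algebraMap ℝ PolynomialSeq (dyckMoment ℓ k) ∈
      meanSquareNull (fun N => jacobiExpectation (N + 1) (ha N) hb₀) hE := by
  induction k using Nat.strong_induction_on with
  | _ k ih =>
  rcases k with _ | n
  · have h0 : dyckMoment ℓ 0 = 1 := rfl
    rw [psumSeq_zero, h0, map_one, sub_self]
    exact zero_mem _
  set E := fun N => jacobiExpectation (N + 1) (ha N) hb₀ with hEdef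
  set A := algebraMap ℝ PolynomialSeq with hA
  set u := psumSeq (n + 1) - A (dyckMoment ℓ (n + 1)) with hu
  set S := ∑ r ∈ Finset.range (n + 1), psumSeq r * psumSeq (n - r) with hS
  set M := ∑ r ∈ Finset.range n, psumSeq (r + 1) * psumSeq (n - r) with hM
  set s := ∑ r ∈ Finset.range (n + 1), dyckMoment ℓ r * dyckMoment ℓ (n - r) with hs
  set m := ∑ r ∈ Finset.range n, dyckMoment ℓ (r + 1) * dyckMoment ℓ (n - r) with hm
  set V := (S - A s) - (M - A m) + (ℓ - 1) • (psumSeq n - A (dyckMoment ℓ n)) with hV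
  set B := invSeq * ((n + 1) * (psumSeq (2 * n + 1) - psumSeq (2 * n + 2))) +
    u * (A (a₀ - 1) * psumSeq n - A (a₀ + b₀ - 2) * psumSeq (n + 1)) with hB
  have hub : u ∈ cubeBounded :=
    sub_mem (psumSeq_mem_cubeBounded _) (Subalgebra.algebraMap_mem _ _)
  have hVnull : V ∈ meanSquareNull E hE := by
    refine add_mem (sub_mem ?_ ?_) (Submodule.smul_mem _ _ (ih n (by omega)))
    · exact sum_mul_psumSeq_sub_mem _ (fun r => r) (fun r => n - r)
        (fun r hr => ih _ (by omega)) (fun r hr => ih _ (by omega))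
    · exact sum_mul_psumSeq_sub_mem _ (fun r => r + 1) (fun r => n - r)
        (fun r hr => ih _ (by omega)) (fun r hr => ih _ (by omega))
  have hBb : B ∈ cubeBounded := by
    refine add_mem (mul_mem invSeq_mem_cubeBounded (mul_mem ?_ (sub_mem
      (psumSeq_mem_cubeBounded _) (psumSeq_mem_cubeBounded _)))) (mul_mem hub (sub_mem
      (mul_mem (Subalgebra.algebraMap_mem _ _) (psumSeq_mem_cubeBounded _))
      (mul_mem (Subalgebra.algebraMap_mem _ _) (psumSeq_mem_cubeBounded _))))
    exact add_mem (natCast_mem _ n) (one_mem _)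
  have hnull : V * u + invSeq * B ∈ meanSquareNull E hE :=
    add_mem (mul_mem_meanSquareNull hVnull hub)
      (mul_mem_meanSquareNull (invSeq_mem_meanSquareNull hE) hBb)
  have hc : A ((ℓ + 1) * dyckMoment ℓ (n + 1) + m) = A (s + (ℓ - 1) * dyckMoment ℓ n) := by
    congr 1
    have h := dyckMoment_convolution (zero_lt_one.trans_le hℓ) n
    rw [sum_range_succ_succ_eq_ends _ _ rfl] at h
    linear_combination h
  have hloop : ∀ N, E N ((V * u + invSeq * B - A (ℓ + 1) * u ^ 2) N) = 0 := by
    intro N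
    rw [← jacobiExpectation_psumSeq_loop (N := N) (ha N) hb₀ n (dyckMoment ℓ (n + 1))]
    congr 1
    have h1 := congrFun (sum_range_succ_succ_eq_ends psumSeq n psumSeq_zero) N
    have hcN := congrFun hc N
    have e1 : C ((ℓ - 1) * ((N : ℝ) + 1) + a₀ - 1) * invSeq N =
        C (ℓ - 1) + C (a₀ - 1) * invSeq N := by
      simp only [invSeq]
      rw [← map_mul, ← map_mul, ← map_add]
      congr 1
      field_simp
      ring
    have e2 : C ((ℓ - 1) * ((N : ℝ) + 1) + a₀ + b₀ - 2) * invSeq N =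
        C (ℓ - 1) + C (a₀ + b₀ - 2) * invSeq N := by
      simp only [invSeq]
      rw [← map_mul, ← map_mul, ← map_add]
      congr 1
      field_simp
      ring
    rw [e1, e2]
    simp only [Finset.sum_apply, Pi.mul_apply, Pi.add_apply, Pi.ofNat_apply] at h1
    rw [h1]
    simp only [hA, Pi.algebraMap_apply, algebraMap_eq, map_add, map_mul, map_sub, map_one] at hcN
    simp only [hB, hV, hu, hS, hM, hA, Pi.mul_apply, Pi.add_apply, Pi.sub_apply, Pi.pow_apply,
      Pi.smul_apply, Pi.algebraMap_apply, Finset.sum_apply, Pi.natCast_apply, Pi.one_apply,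
      algebraMap_eq, smul_eq_C_mul]
    simp only [map_add, map_sub, map_one]
    linear_combination (psumSeq (n + 1) N - C (dyckMoment ℓ (n + 1))) * hcN
  have hsq : ∀ N, E N (u N ^ 2) = (ℓ + 1)⁻¹ * E N ((V * u + invSeq * B) N) := by
    intro N
    have h := hloop N
    have e : (V * u + invSeq * B - A (ℓ + 1) * u ^ 2) N =
        (V * u + invSeq * B) N - (ℓ + 1) • (u N ^ 2) := by
      rw [smul_eq_C_mul]
      rfl
    rw [e, map_sub, map_smul, smul_eq_mul] at h
    have : ℓ + 1 ≠ 0 := by linarith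
    rw [eq_inv_mul_iff_mul_eq₀ this]
    linarith
  refine Filter.Tendsto.congr (fun N => (hsq N).symm) ?_
  simpa using (tendsto_of_mem_meanSquareNull hnull).const_mul (ℓ + 1)⁻¹

theorem Ik_div_N_limit_symmetric_dyck (k : ℕ) (hk : 1 ≤ k) (ℓ a₀ b₀ : ℝ)
    (hℓ : 1 ≤ ℓ) (hb₀ : 0 < b₀)
    (ha : ∀ N : ℕ, 1 ≤ N → 0 < (ℓ - 1) * (N : ℝ) + a₀) :
    Filter.Tendsto
      (fun N : ℕ => Ik k N ((ℓ - 1) * (N : ℝ) + a₀) b₀ / (N : ℝ))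
      Filter.atTop
      (nhds (ℓ / (1 + ℓ) ^ (2 * k - 1) *
        ∑ i ∈ Finset.range (2 * (k - 1) + 1),
          ((k - 1).choose ((i + 1) / 2) : ℝ) * ((k - 1).choose (i / 2) : ℝ) * ℓ ^ i)) := by
  obtain ⟨n, rfl⟩ : ∃ n, k = n + 1 := ⟨k - 1, by omega⟩
  have hlim : ℓ / (1 + ℓ) ^ (2 * (n + 1) - 1) *
      ∑ i ∈ Finset.range (2 * (n + 1 - 1) + 1),
        ((n + 1 - 1).choose ((i + 1) / 2) : ℝ) * ((n + 1 - 1).choose (i / 2) : ℝ) * ℓ ^ i =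
      dyckMoment ℓ (n + 1) := by
    simp only [dyckMoment, symmDyckPoly, Polynomial.eval_finsetSum, Polynomial.eval_monomial]
    rfl
  rw [hlim, ← Filter.tendsto_add_atTop_iff_nat 1]
  have ha' : ∀ N : ℕ, 0 < (ℓ - 1) * ((N : ℝ) + 1) + a₀ := fun N => by
    have := ha (N + 1) (by omega)
    push_cast at this
    exact this
  have hE := fun N => isCubeState_jacobiExpectation (N := N + 1) (ha' N) hb₀
  have h := tendsto_of_mem_meanSquareNull
    (psumSeq_sub_dyckMoment_mem hℓ hb₀ ha' hE (n + 1))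
  have h2 := h.add_const (dyckMoment ℓ (n + 1))
  rw [zero_add] at h2
  refine h2.congr fun N => ?_
  rw [Pi.sub_apply, map_sub, Pi.algebraMap_apply, algebraMap_eq, (hE N).map_C, sub_add_cancel,
    psumSeq, ← smul_eq_C_mul, map_smul, smul_eq_mul]
  push_cast
  rw [Ik_eq_jacobiExpectation_psum (ha' N) hb₀, div_eq_inv_mul]
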